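/- arXiv:2507.18843 — 2 statements merged into one kernel-verified Lean document; each statement's English description precedes it below -/
import Mathlib

section
/- With A and J the n×n quaternionic matrices defined in the context, one has A² = −J, J·A = A, and A³ = −A. -/
open Matrix
open scoped Quaternion

/-- With `A` and `J` the `n×n` quaternionic matrices defined in the context,
one has `A² = −J`, `J·A = A` and `A³ = −A`. -/
theorem stmt_8 (n : ℕ) (hn : 2 ≤ n) (z : ℍ[ℝ]) (hz : z + star z = 0)
    (v : Fin (n - 1) → ℍ[ℝ]) (hv : v ≠ 0)
    (hnorm : Quaternion.normSq z + ∑ i, Quaternion.normSq (v i) = 1)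
    (A J : Matrix (Fin 1 ⊕ Fin (n - 1)) (Fin 1 ⊕ Fin (n - 1)) ℍ[ℝ])
    (hA : A = Matrix.fromBlocks
      (Matrix.of fun _ _ => z)
      (Matrix.of fun _ j => -star (v j))
      (Matrix.of fun i _ => v i)
      (Matrix.of fun i j =>
        -(v i * z * star (v j)) / ((∑ k, Quaternion.normSq (v k) : ℝ) : ℍ[ℝ])))
    (hJ : J = Matrix.fromBlocks 1 0 0
      (Matrix.of fun i j =>
        v i * star (v j) / ((∑ k, Quaternion.normSq (v k) : ℝ) : ℍ[ℝ]))) :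
    A ^ 2 = -J ∧ J * A = A ∧ A ^ 3 = -A := by
  obtain ⟨s, hs⟩ : ∃ s : ℝ, s = ∑ k, Quaternion.normSq (v k) := ⟨_, rfl⟩
  have hs0 : s ≠ 0 := by
    intro h0
    apply hv
    rw [hs, Finset.sum_eq_zero_iff_of_nonneg (fun i _ => Quaternion.normSq_nonneg)] at h0
    funext i
    exact Quaternion.normSq_eq_zero.1 (h0 i (Finset.mem_univ i))
  rw [← hs] at hnorm hA hJ
  let V : Matrix (Fin (n - 1)) (Fin 1) ℍ[ℝ] := Matrix.of fun i _ => v i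
  let Z : Matrix (Fin 1) (Fin 1) ℍ[ℝ] := Matrix.of fun _ _ => z
  have hdiv : ∀ q : ℍ[ℝ], q / (s : ℍ[ℝ]) = s⁻¹ • q := by
    intro q
    rw [div_eq_mul_inv, ← Quaternion.coe_inv, Quaternion.mul_coe_eq_smul]
  have hA' : A = Matrix.fromBlocks Z (-Vᴴ) V (-(s⁻¹ • (V * Z * Vᴴ))) := by
    rw [hA]
    congr 1
    ext1 i j
    simp [hdiv, V, Z, Matrix.mul_apply]
  have hJ' : J = Matrix.fromBlocks 1 0 0 (s⁻¹ • (V * Vᴴ)) := by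
    rw [hJ]
    congr 1
    ext1 i j
    simp [hdiv, V, Matrix.mul_apply]
  have hVV : Vᴴ * V = s • (1 : Matrix (Fin 1) (Fin 1) ℍ[ℝ]) := by
    ext1 i j
    rw [Subsingleton.elim i j, Matrix.mul_apply, Matrix.smul_apply, Matrix.one_apply_eq, hs]
    simp only [V, Matrix.conjTranspose_apply, Matrix.of_apply, Quaternion.star_mul_self]
    rw [← Quaternion.coe_mul_eq_smul, mul_one]
    exact (map_sum (algebraMap ℝ ℍ[ℝ]) _ _).symm
  have hZZ : Z * Z = (s - 1) • (1 : Matrix (Fin 1) (Fin 1) ℍ[ℝ]) := by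
    ext1 i j
    rw [Subsingleton.elim i j, Matrix.mul_apply, Matrix.smul_apply, Matrix.one_apply_eq]
    simp only [Z, Matrix.of_apply, Finset.univ_unique, Finset.sum_singleton]
    have h1 : z = - star z := eq_neg_of_add_eq_zero_left hz
    have h2 : s - 1 = - Quaternion.normSq z := by linarith
    rw [h2, ← Quaternion.coe_mul_eq_smul, mul_one, Quaternion.coe_neg, ← Quaternion.self_mul_star,
      ← mul_neg, ← h1]
  have hVV' : ∀ {m : Type} (X : Matrix (Fin 1) m ℍ[ℝ]), Vᴴ * (V * X) = s • X := by
    intro m X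
    rw [← Matrix.mul_assoc, hVV, Matrix.smul_mul, Matrix.one_mul]
  have hZZ' : ∀ {m : Type} (X : Matrix (Fin 1) m ℍ[ℝ]), Z * (Z * X) = (s - 1) • X := by
    intro m X
    rw [← Matrix.mul_assoc, hZZ, Matrix.smul_mul, Matrix.one_mul]
  have e1 : A ^ 2 = -J := by
    rw [hA', hJ', pow_two, Matrix.fromBlocks_multiply, Matrix.fromBlocks_neg]
    congr 1
    · rw [Matrix.neg_mul, hVV, hZZ]; module
    · simp [Matrix.mul_assoc, hVV', smul_smul, hs0]
    · simp [Matrix.mul_assoc, hVV, smul_smul, hs0]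
    · simp only [Matrix.mul_assoc, hVV', hZZ', Matrix.neg_mul, Matrix.mul_neg, Matrix.smul_mul,
        Matrix.mul_smul, neg_neg, smul_smul]
      match_scalars
      field_simp
      ring
  have e2 : J * A = A := by
    rw [hA', hJ', Matrix.fromBlocks_multiply]
    congr 1
    · simp
    · simp
    · simp [Matrix.mul_assoc, hVV, smul_smul, hs0]
    · simp [Matrix.mul_assoc, hVV', smul_smul, hs0]
  refine ⟨e1, e2, ?_⟩
  rw [pow_succ, e1, Matrix.neg_mul, e2]
end

section
/- Let k = [[0,1],[−1,0]], k₂ = [[1,0],[0,−1]], and I₂ the 2×2 identity, and define the 6×6 block-diagonal real matrices s₁ = diag(k, k, I₂) and s₂ = diag(I₂, k₂, k₂). Then: (i) s₁ and s₂ are orthogonal with determinant 1; (ii) s₂² = I₆; (iii) s₁² = diag(−I₂, −I₂, I₂), and s₁² commutes with s₂; (iv) (s₁s₂)² = (s₂s₁)²; and (v) the subgroup of GL(6,ℝ) generated by s₁ and s₂ has exactly 16 elements. -/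
open Matrix


/-- Integer model of `s₁`. -/
def intA : Matrix (Fin 6) (Fin 6) ℤ :=
  !![0, 1, 0, 0, 0, 0; -1, 0, 0, 0, 0, 0; 0, 0, 0, 1, 0, 0;
     0, 0, -1, 0, 0, 0; 0, 0, 0, 0, 1, 0; 0, 0, 0, 0, 0, 1]

/-- Integer model of `s₂`. -/
def intB : Matrix (Fin 6) (Fin 6) ℤ :=
  !![1, 0, 0, 0, 0, 0; 0, 1, 0, 0, 0, 0; 0, 0, 1, 0, 0, 0;
     0, 0, 0, -1, 0, 0; 0, 0, 0, 0, 1, 0; 0, 0, 0, 0, 0, -1]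

theorem intA_pow : intA ^ 4 = 1 := by decide +kernel
theorem intB_pow : intB ^ 2 = 1 := by decide +kernel
theorem int_rel : intB * intA = intA ^ 3 * intB * (intA * intB) ^ 2 := by decide +kernel
theorem int_z : ((intA * intB) ^ 2) ^ 2 = 1 := by decide +kernel
theorem int_za : (intA * intB) ^ 2 * intA = intA * (intA * intB) ^ 2 := by decide +kernel
theorem int_zb : (intA * intB) ^ 2 * intB = intB * (intA * intB) ^ 2 := by decide +kernel

theorem int_inj : ∀ p q : Fin 4 × Fin 2 × Fin 2,
    intA ^ p.1.val * intB ^ p.2.1.val * ((intA * intB) ^ 2) ^ p.2.2.val =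
    intA ^ q.1.val * intB ^ q.2.1.val * ((intA * intB) ^ 2) ^ q.2.2.val → p = q := by
  decide +kernel

/-- Normal forms: abstract counting lemma. -/
theorem card_closure_aux {G : Type*} [Group G] (a b z : G) (ha : a ^ 4 = 1) (hb : b ^ 2 = 1)
    (hz : z ^ 2 = 1) (hba : b * a = a ^ 3 * b * z) (hzd : z = (a * b) ^ 2)
    (hza : z * a = a * z) (hzb : z * b = b * z)
    (hinj : ∀ p q : Fin 4 × Fin 2 × Fin 2,
      a ^ p.1.val * b ^ p.2.1.val * z ^ p.2.2.val =
      a ^ q.1.val * b ^ q.2.1.val * z ^ q.2.2.val → p = q) :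
    Nat.card (Subgroup.closure ({a, b} : Set G)) = 16 := by
  have hmem : ∀ i j k : ℕ, a ^ i * b ^ j * z ^ k ∈ Set.range
      (fun p : Fin 4 × Fin 2 × Fin 2 => a ^ p.1.val * b ^ p.2.1.val * z ^ p.2.2.val) := by
    intro i j k
    refine ⟨(⟨i % 4, Nat.mod_lt _ (by norm_num)⟩, ⟨j % 2, Nat.mod_lt _ (by norm_num)⟩,
      ⟨k % 2, Nat.mod_lt _ (by norm_num)⟩), ?_⟩
    simp only
    rw [← pow_eq_pow_mod i ha, ← pow_eq_pow_mod j hb, ← pow_eq_pow_mod k hz]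
  have hZa : Commute z a := hza
  have hZb : Commute z b := hzb
  have hbai : ∀ i : ℕ, b * a ^ i = a ^ (3 * i) * b * z ^ i := by
    intro i
    induction i with
    | zero => simp
    | succ n ih =>
      calc b * a ^ (n + 1) = (b * a ^ n) * a := by rw [pow_succ, mul_assoc]
        _ = a ^ (3 * n) * b * (z ^ n * a) := by rw [ih, mul_assoc]
        _ = a ^ (3 * n) * (b * a) * z ^ n := by rw [(hZa.pow_left n).eq]; simp only [mul_assoc]
        _ = a ^ (3 * (n + 1)) * b * z ^ (n + 1) := by
          rw [hba, mul_add, pow_add, pow_succ' z]; simp only [mul_assoc, mul_one]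
  have hain : a⁻¹ = a ^ 3 := inv_eq_of_mul_eq_one_left (by rw [← pow_succ, ha])
  have hbin : b⁻¹ = b := inv_eq_of_mul_eq_one_left (by rw [← sq, hb])
  have hA : ∀ n i j k : ℕ, a ^ n * (a ^ i * b ^ j * z ^ k) = a ^ (n + i) * b ^ j * z ^ k := by
    intro n i j k; rw [pow_add]; simp only [mul_assoc]
  have hB : ∀ i j k : ℕ, b * (a ^ i * b ^ j * z ^ k)
      = a ^ (3 * i) * b ^ (j + 1) * z ^ (i + k) := by
    intro i j k
    calc b * (a ^ i * b ^ j * z ^ k) = (b * a ^ i) * b ^ j * z ^ k := by simp only [mul_assoc]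
      _ = a ^ (3 * i) * b * (z ^ i * b ^ j) * z ^ k := by rw [hbai]; simp only [mul_assoc]
      _ = _ := by
        rw [((hZb.pow_left i).pow_right j).eq, pow_succ', pow_add]; simp only [mul_assoc]
  have hset : ((Subgroup.closure ({a, b} : Set G) : Subgroup G) : Set G) = Set.range
      (fun p : Fin 4 × Fin 2 × Fin 2 => a ^ p.1.val * b ^ p.2.1.val * z ^ p.2.2.val) := by
    apply Set.Subset.antisymm
    · intro x hx
      induction hx using Subgroup.closure_induction_left with
      | one => simpa using hmem 0 0 0
      | mul_left x hx y hy ih =>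
        obtain ⟨p, rfl⟩ := ih
        rcases hx with rfl | rfl
        · have := hA 1 p.1 p.2.1 p.2.2
          rw [pow_one] at this
          simp only [this]; exact hmem _ _ _
        · simp only [hB]; exact hmem _ _ _
      | inv_mul_cancel x hx y hy ih =>
        obtain ⟨p, rfl⟩ := ih
        rcases hx with rfl | rfl
        · simp only [hain, hA]; exact hmem _ _ _
        · simp only [hbin, hB]; exact hmem _ _ _
    · rintro _ ⟨p, rfl⟩
      have h1 : a ∈ Subgroup.closure ({a, b} : Set G) := Subgroup.subset_closure (by simp)
      have h2 : b ∈ Subgroup.closure ({a, b} : Set G) := Subgroup.subset_closure (by simp)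
      have h3 : z ∈ Subgroup.closure ({a, b} : Set G) := by
        rw [hzd]; exact pow_mem (mul_mem h1 h2) 2
      exact mul_mem (mul_mem (pow_mem h1 _) (pow_mem h2 _)) (pow_mem h3 _)
  change Nat.card ((Subgroup.closure ({a, b} : Set G) : Subgroup G) : Set G) = 16
  rw [hset, Nat.card_range_of_injective (fun p q h => hinj p q h)]
  simp

set_option maxHeartbeats 2000000 in
/-- With `s₁ = diag(k, k, I₂)` and `s₂ = diag(I₂, k₂, k₂)` the indicated `6×6`
block-diagonal real matrices: (i) `s₁` and `s₂` are orthogonal with determinant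
`1`; (ii) `s₂² = I₆`; (iii) `s₁² = diag(−I₂, −I₂, I₂)` and `s₁²` commutes with
`s₂`; (iv) `(s₁s₂)² = (s₂s₁)²`; (v) the subgroup of `GL(6,ℝ)` generated by `s₁`
and `s₂` has exactly `16` elements.  (The generators are realized as elements
`g₁, g₂` of `GL(6,ℝ)` whose underlying matrices are `s₁, s₂`.) -/
theorem stmt_17 (g₁ g₂ : GL (Fin 6) ℝ)
    (hg₁ : (g₁ : Matrix (Fin 6) (Fin 6) ℝ) =
      !![0, 1, 0, 0, 0, 0;
        -1, 0, 0, 0, 0, 0;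
         0, 0, 0, 1, 0, 0;
         0, 0,-1, 0, 0, 0;
         0, 0, 0, 0, 1, 0;
         0, 0, 0, 0, 0, 1])
    (hg₂ : (g₂ : Matrix (Fin 6) (Fin 6) ℝ) =
      !![1, 0, 0, 0, 0, 0;
         0, 1, 0, 0, 0, 0;
         0, 0, 1, 0, 0, 0;
         0, 0, 0,-1, 0, 0;
         0, 0, 0, 0, 1, 0;
         0, 0, 0, 0, 0,-1]) :
    let s₁ : Matrix (Fin 6) (Fin 6) ℝ := (g₁ : Matrix (Fin 6) (Fin 6) ℝ)
    let s₂ : Matrix (Fin 6) (Fin 6) ℝ := (g₂ : Matrix (Fin 6) (Fin 6) ℝ)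
    (s₁ * s₁ᵀ = 1 ∧ s₁.det = 1 ∧ s₂ * s₂ᵀ = 1 ∧ s₂.det = 1) ∧
    s₂ ^ 2 = 1 ∧
    (s₁ ^ 2 = Matrix.diagonal ![-1, -1, -1, -1, 1, 1] ∧ s₁ ^ 2 * s₂ = s₂ * s₁ ^ 2) ∧
    (s₁ * s₂) ^ 2 = (s₂ * s₁) ^ 2 ∧
    Nat.card (Subgroup.closure ({g₁, g₂} : Set (GL (Fin 6) ℝ))) = 16 := by

  have hinjF : Function.Injective ((Int.castRingHom ℝ).mapMatrix (m := Fin 6)) :=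
    Matrix.map_injective (RingHom.injective_int (Int.castRingHom ℝ))
  set F := (Int.castRingHom ℝ).mapMatrix (m := Fin 6) with hF
  have e1 : (g₁ : Matrix (Fin 6) (Fin 6) ℝ) = F intA := by
    rw [hg₁]; ext i j; fin_cases i <;> fin_cases j <;> simp [hF, intA]
  have e2 : (g₂ : Matrix (Fin 6) (Fin 6) ℝ) = F intB := by
    rw [hg₂]; ext i j; fin_cases i <;> fin_cases j <;> simp [hF, intB]
  have t : ∀ M : Matrix (Fin 6) (Fin 6) ℤ, (F M)ᵀ = F Mᵀ := fun M => rfl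
  have hd : Matrix.diagonal ![-1, -1, -1, -1, 1, 1] =
      F (Matrix.diagonal ![-1, -1, -1, -1, 1, 1]) := by
    ext i j; fin_cases i <;> fin_cases j <;> simp [hF]
  intro s₁ s₂
  refine ⟨⟨?_, ?_, ?_, ?_⟩, ?_, ⟨?_, ?_⟩, ?_, ?_⟩
  · change (g₁ : Matrix (Fin 6) (Fin 6) ℝ) * (g₁ : Matrix (Fin 6) (Fin 6) ℝ)ᵀ = 1
    rw [e1, t, ← map_mul, ← map_one F]; exact congrArg F (by decide +kernel)
  · change (g₁ : Matrix (Fin 6) (Fin 6) ℝ).det = 1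
    rw [hg₁]; simp [Matrix.det_succ_row_zero, Fin.sum_univ_succ, Fin.succAbove]
  · change (g₂ : Matrix (Fin 6) (Fin 6) ℝ) * (g₂ : Matrix (Fin 6) (Fin 6) ℝ)ᵀ = 1
    rw [e2, t, ← map_mul, ← map_one F]; exact congrArg F (by decide +kernel)
  · change (g₂ : Matrix (Fin 6) (Fin 6) ℝ).det = 1
    rw [hg₂]; simp [Matrix.det_succ_row_zero, Fin.sum_univ_succ, Fin.succAbove]
  · change (g₂ : Matrix (Fin 6) (Fin 6) ℝ) ^ 2 = 1
    rw [e2, ← map_pow, intB_pow, map_one]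
  · change (g₁ : Matrix (Fin 6) (Fin 6) ℝ) ^ 2 = _
    rw [e1, ← map_pow, hd]; exact congrArg F (by decide +kernel)
  · change (g₁ : Matrix (Fin 6) (Fin 6) ℝ) ^ 2 * (g₂ : Matrix (Fin 6) (Fin 6) ℝ) =
      (g₂ : Matrix (Fin 6) (Fin 6) ℝ) * (g₁ : Matrix (Fin 6) (Fin 6) ℝ) ^ 2
    rw [e1, e2, ← map_pow, ← map_mul, ← map_mul]; exact congrArg F (by decide +kernel)
  · change ((g₁ : Matrix (Fin 6) (Fin 6) ℝ) * (g₂ : Matrix (Fin 6) (Fin 6) ℝ)) ^ 2 =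
      ((g₂ : Matrix (Fin 6) (Fin 6) ℝ) * (g₁ : Matrix (Fin 6) (Fin 6) ℝ)) ^ 2
    rw [e1, e2, ← map_mul, ← map_mul, ← map_pow, ← map_pow]; exact congrArg F (by decide +kernel)
  · refine card_closure_aux g₁ g₂ ((g₁ * g₂) ^ 2) ?_ ?_ ?_ ?_ rfl ?_ ?_ ?_
    · apply Units.ext; simp only [Units.val_pow_eq_pow_val, Units.val_mul, Units.val_one, e1, e2]
      simp only [← map_pow, ← map_mul, intA_pow, map_one]
    · apply Units.ext; simp only [Units.val_pow_eq_pow_val, Units.val_mul, Units.val_one, e1, e2]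
      simp only [← map_pow, ← map_mul, intB_pow, map_one]
    · apply Units.ext; simp only [Units.val_pow_eq_pow_val, Units.val_mul, Units.val_one, e1, e2]
      simp only [← map_pow, ← map_mul, int_z, map_one]
    · apply Units.ext; simp only [Units.val_pow_eq_pow_val, Units.val_mul, e1, e2]
      simp only [← map_pow, ← map_mul]
      exact congrArg F int_rel
    · apply Units.ext; simp only [Units.val_pow_eq_pow_val, Units.val_mul, e1, e2]
      simp only [← map_pow, ← map_mul]
      exact congrArg F int_za
    · apply Units.ext; simp only [Units.val_pow_eq_pow_val, Units.val_mul, e1, e2]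
      simp only [← map_pow, ← map_mul]
      exact congrArg F int_zb
    · intro p q h
      have h := congrArg (Units.val) h
      simp only [Units.val_pow_eq_pow_val, Units.val_mul, e1, e2] at h
      simp only [← map_pow, ← map_mul] at h
      exact int_inj p q (hinjF h)
end
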